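/- Let I be a purely infinite simple exchange ring which is an essential two-sided ideal of a unital ring R. Let p, q be idempotents of R with p ∈ I. If pRq ≠ 0, then for any equation xa + b = q with a ∈ pRq, x ∈ qRp, b ∈ qRq, there exists w ∈ pRq quasi-invertible in the skew corner pRq (i.e., w has y ∈ qRp with (p - wy) ⊥ (q - yw)) and an element c with a + c·b = w for some c ∈ pRq; in particular pRq is contained in the left closure cl~((pRq)_q^{-1}). -/

import Mathlib

section
variable {R : Type*} [Ring R]

/-- `x` and `y` are centrally orthogonal in `R`: `xRy = 0 = yRx`. -/
def CentOrth (x y : R) : Prop := ∀ r : R, x * r * y = 0 ∧ y * r * x = 0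

/-- `p` is an infinite idempotent with all witnesses inside the subset `I`. -/
def IsInfiniteIdemIn (I : Set R) (p : R) : Prop :=
  p * p = p ∧ p ≠ 0 ∧ p ∈ I ∧
    ∃ q x y : R, q ∈ I ∧ x ∈ I ∧ y ∈ I ∧ q * q = q ∧ q * p = q ∧ p * q = q ∧ q ≠ p ∧
      x = q * x * p ∧ y = p * y * q ∧ x * y = q ∧ y * x = p

/-- `J` is a right ideal of the (non-unital) ring `I`. -/
def IsRightIdealOf (I J : Set R) : Prop :=
  J ⊆ I ∧ (0 : R) ∈ J ∧ (∀ a b, a ∈ J → b ∈ J → a + b ∈ J) ∧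
    ∀ a x, a ∈ J → x ∈ I → a * x ∈ J

/-- `J` is a two-sided ideal of the (non-unital) ring `I`. -/
def IsIdealOf (I J : Set R) : Prop :=
  IsRightIdealOf I J ∧ ∀ a x, a ∈ J → x ∈ I → x * a ∈ J

/-- The ring `I` is purely infinite and simple. -/
def IsPISIdeal (I : Set R) : Prop :=
  (∃ z ∈ I, z ≠ 0) ∧
    (∀ J : Set R, IsIdealOf I J → J = {0} ∨ J = I) ∧
    ∀ J : Set R, IsRightIdealOf I J → (∃ z ∈ J, z ≠ 0) →
      ∃ p ∈ J, IsInfiniteIdemIn I p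

/-- `I` is an exchange ring (non-unital formulation). -/
def IsExchangeIdeal (I : Set R) : Prop :=
  ∀ x ∈ I, ∃ p s : R, s ∈ I ∧ p = x + s - x * s ∧ p * p = p ∧ ∃ t ∈ I, p = x * t

/-- `I` is an essential ideal of `R`. -/
def IsEssentialIdeal (I : TwoSidedIdeal R) : Prop :=
  ∀ J : TwoSidedIdeal R, J ≠ ⊥ → ∃ z : R, z ∈ J ∧ z ∈ I ∧ z ≠ 0

/-- Every element of a simple ideal factors through any of its infinite idempotents. -/
theorem IsInfiniteIdemIn.exists_factor {I : TwoSidedIdeal R} (hPIS : IsPISIdeal (I : Set R))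
    {f : R} (hf : IsInfiniteIdemIn (I : Set R) f) {p : R} (hp : p ∈ I) :
    ∃ u v : R, u * f * v = p := by
  obtain ⟨hff, -, hfI, g, x, y, hgI, -, -, hgg, hgf, hfg, hne, hx, hy, hxy, hyx⟩ := hf
  have hfx : f * x = x := by rw [hx]; simp only [← mul_assoc, hfg]
  have hgx : g * x = x := by rw [hx]; simp only [← mul_assoc, hgg]
  have hyg : y * g = y := by rw [hy]; simp only [mul_assoc, hgg]
  have hyf : y * f = y := by rw [hy]; simp only [mul_assoc, hgf]
  have hhI : f - g ∈ I := I.sub_mem hfI hgI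
  have hh0 : f - g ≠ 0 := fun h0 => hne (sub_eq_zero.mp h0).symm
  have hhh : (f - g) * (f - g) = f - g := by
    simp only [sub_mul, mul_sub, hff, hfg, hgf, hgg]; abel
  have hhf : (f - g) * f = f - g := by rw [sub_mul, hff, hgf]
  have hfh : f * (f - g) = f - g := by rw [mul_sub, hff, hfg]
  have hyh : y * (f - g) = 0 := by rw [mul_sub, hyf, hyg, sub_self]
  have hhx : (f - g) * x = 0 := by rw [sub_mul, hfx, hgx, sub_self]
  generalize f - g = h at *
  let S : AddSubgroup R := AddSubgroup.closure {z | ∃ a b : R, z = a * h * b}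
  have hS : ∀ z ∈ S, ∃ u v : R, u * f * v = z := by
    intro z hz
    induction hz using AddSubgroup.closure_induction_left with
    | zero => exact ⟨0, 0, by simp⟩
    | add_left z₁ hz₁ z₂ _ ih =>
      obtain ⟨a, b, rfl⟩ := hz₁
      obtain ⟨u, v, rfl⟩ := ih
      exact ⟨u * y + a * h, x * f * v + h * b, by
        calc _ = u * ((y * f) * x) * f * v + u * ((y * f) * h) * b
              + a * ((h * f) * x) * f * v + a * ((h * f) * h) * b := by noncomm_ring
          _ = _ := by
            rw [hyf, hyx, hyh, hhf, hhx, hhh, mul_assoc u f f, hff]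
            noncomm_ring⟩
    | neg_add_cancel z₁ hz₁ z₂ _ ih =>
      obtain ⟨a, b, rfl⟩ := hz₁
      obtain ⟨u, v, rfl⟩ := ih
      exact ⟨u * y + -a * h, x * f * v + h * b, by
        calc _ = u * ((y * f) * x) * f * v + u * ((y * f) * h) * b
              - a * ((h * f) * x) * f * v - a * ((h * f) * h) * b := by noncomm_ring
          _ = _ := by
            rw [hyf, hyx, hyh, hhf, hhx, hhh, mul_assoc u f f, hff]
            noncomm_ring⟩
  have hl : ∀ r, ∀ z ∈ S, r * z ∈ S := by
    intro r z hz
    induction hz using AddSubgroup.closure_induction with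
    | mem z hz =>
      obtain ⟨a, b, rfl⟩ := hz
      exact AddSubgroup.subset_closure ⟨r * a, b, by simp only [mul_assoc]⟩
    | zero => simp [S.zero_mem]
    | add _ _ _ _ h₁ h₂ => rw [mul_add]; exact S.add_mem h₁ h₂
    | neg _ _ h₁ => rw [mul_neg]; exact S.neg_mem h₁
  have hr : ∀ r, ∀ z ∈ S, z * r ∈ S := by
    intro r z hz
    induction hz using AddSubgroup.closure_induction with
    | mem z hz =>
      obtain ⟨a, b, rfl⟩ := hz
      exact AddSubgroup.subset_closure ⟨a, b * r, by simp only [mul_assoc]⟩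
    | zero => simp [S.zero_mem]
    | add _ _ _ _ h₁ h₂ => rw [add_mul]; exact S.add_mem h₁ h₂
    | neg _ _ h₁ => rw [neg_mul]; exact S.neg_mem h₁
  have hJ : IsIdealOf (I : Set R) {z | z ∈ I ∧ z ∈ S} :=
    ⟨⟨fun z hz => hz.1, ⟨I.zero_mem, S.zero_mem⟩,
      fun a b ha hb => ⟨I.add_mem ha.1 hb.1, S.add_mem ha.2 hb.2⟩,
      fun a r ha _ => ⟨I.mul_mem_right _ _ ha.1, hr r a ha.2⟩⟩,
      fun a r ha _ => ⟨I.mul_mem_left _ _ ha.1, hl r a ha.2⟩⟩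
  have hhJ : h ∈ {z | z ∈ I ∧ z ∈ S} :=
    ⟨hhI, AddSubgroup.subset_closure ⟨1, 1, by simp⟩⟩
  rcases hPIS.2.1 _ hJ with h0 | h0
  · rw [h0] at hhJ
    exact absurd hhJ hh0
  · have hpJ : p ∈ {z | z ∈ I ∧ z ∈ S} := by rw [h0]; exact hp
    exact hS p hpJ.2

theorem isRightIdealOf_mul_left (I : TwoSidedIdeal R) (b : R) :
    IsRightIdealOf (I : Set R) {z | ∃ t ∈ I, z = b * t} := by
  refine ⟨?_, ⟨0, I.zero_mem, by simp⟩, ?_, ?_⟩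
  · rintro _ ⟨t, ht, rfl⟩
    exact I.mul_mem_left _ _ ht
  · rintro _ _ ⟨t, ht, rfl⟩ ⟨s, hs, rfl⟩
    exact ⟨t + s, I.add_mem ht hs, (mul_add _ _ _).symm⟩
  · rintro _ r ⟨t, ht, rfl⟩ _
    exact ⟨t * r, I.mul_mem_right _ _ ht, mul_assoc _ _ _⟩

/-- In a purely infinite simple ideal every idempotent is subequivalent to every nonzero one. -/
theorem IsPISIdeal.exists_subequiv {I : TwoSidedIdeal R} (hPIS : IsPISIdeal (I : Set R))
    {p e : R} (hp : p * p = p) (hpI : p ∈ I) (he : e * e = e) (heI : e ∈ I) (he0 : e ≠ 0) :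
    ∃ u v : R, u = p * u * e ∧ v = e * v * p ∧ u * v = p := by
  obtain ⟨f, ⟨t, -, hft⟩, hf⟩ :=
    hPIS.2.2 _ (isRightIdealOf_mul_left I e) ⟨e, ⟨e, heI, he.symm⟩, he0⟩
  obtain ⟨u, v, huv⟩ := hf.exists_factor hPIS hpI
  have hef : e * f = f := by rw [hft, ← mul_assoc, he]
  refine ⟨p * u * e, e * f * v * p, ?_, ?_, ?_⟩
  · calc p * u * e = (p * p) * u * (e * e) := by rw [hp, he]
      _ = _ := by simp only [mul_assoc]
  · calc e * f * v * p = (e * e) * f * v * (p * p) := by rw [hp, he]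
      _ = _ := by simp only [mul_assoc]
  · calc p * u * e * (e * f * v * p) = p * (u * ((e * e) * f) * v) * p := by
          simp only [mul_assoc]
      _ = p := by rw [he, hef, huv, hp, hp]

/-- An essential purely infinite ideal has zero left annihilator. -/
theorem IsEssentialIdeal.exists_mul_ne_zero {I : TwoSidedIdeal R}
    (hEss : IsEssentialIdeal I) (hPIS : IsPISIdeal (I : Set R)) {b : R} (hb : b ≠ 0) :
    ∃ t ∈ I, b * t ≠ 0 := by
  by_contra! hbI
  let J : TwoSidedIdeal R := TwoSidedIdeal.mk' {r | ∀ t ∈ I, r * t = 0}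
    (by simp)
    (fun hx hy t ht => by rw [add_mul, hx t ht, hy t ht, add_zero])
    (fun hx t ht => by rw [neg_mul, hx t ht, neg_zero])
    (fun hy t ht => by rw [mul_assoc, hy t ht, mul_zero])
    (fun hx t ht => by rw [mul_assoc]; exact hx _ (I.mul_mem_left _ _ ht))
  have hmem : ∀ r, r ∈ J ↔ ∀ t ∈ I, r * t = 0 := fun r => by
    simp only [J, TwoSidedIdeal.mem_mk', Set.mem_ofPred_eq]
  have hJ : J ≠ ⊥ := fun h => hb (by
    have : b ∈ J := (hmem b).2 hbI
    rwa [h, TwoSidedIdeal.mem_bot] at this)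
  obtain ⟨z, hzJ, hzI, hz0⟩ := hEss J hJ
  obtain ⟨e, he, hee, he0, -⟩ := hPIS.2.2 {z | z ∈ I ∧ z ∈ J}
    ⟨fun z hz => hz.1, ⟨I.zero_mem, J.zero_mem⟩,
      fun a b ha hb => ⟨I.add_mem ha.1 hb.1, J.add_mem ha.2 hb.2⟩,
      fun a r ha _ => ⟨I.mul_mem_right _ _ ha.1, J.mul_mem_right _ _ ha.2⟩⟩
    ⟨z, ⟨hzI, hzJ⟩, hz0⟩
  exact he0 (hee ▸ (hmem e).1 he.2 e he.1)

/-- Every nonzero `b` has a left multiple which is a nonzero idempotent of `I`. -/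
theorem IsEssentialIdeal.exists_idem_left_multiple {I : TwoSidedIdeal R}
    (hEss : IsEssentialIdeal I) (hPIS : IsPISIdeal (I : Set R)) {b : R} (hb : b ≠ 0) :
    ∃ s : R, (s * b) * (s * b) = s * b ∧ s * b ∈ I ∧ s * b ≠ 0 := by
  obtain ⟨t, ht, hbt⟩ := hEss.exists_mul_ne_zero hPIS hb
  obtain ⟨f, ⟨t, htI, rfl⟩, hff, hf0, -⟩ :=
    hPIS.2.2 _ (isRightIdealOf_mul_left I b) ⟨b * t, ⟨t, ht, rfl⟩, hbt⟩
  refine ⟨t * (b * t), ?_, ?_, fun h => hf0 ?_⟩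
  · calc t * (b * t) * b * (t * (b * t) * b)
        = t * ((b * t) * (b * t) * (b * t)) * b := by simp only [mul_assoc]
      _ = _ := by rw [hff, hff]
  · rw [mul_assoc]
    exact I.mul_mem_right _ _ htI
  · calc b * t = (b * t) * (b * t) * (b * t) := by rw [hff, hff]
      _ = b * (t * (b * t)) * (b * t) := by simp only [mul_assoc]
      _ = b * (t * (b * t) * b) * t := by simp only [mul_assoc]
      _ = 0 := by rw [h]; simp

/-- Let `I` be a purely infinite simple exchange ring which is an essential ideal of `R`,
and `p, q` idempotents with `p ∈ I` and `pRq ≠ 0`. Then for any equation `xa + b = q`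
in the skew corner there are `w ∈ (pRq)_q⁻¹` and `c ∈ pRq` with `a + cb = w`; in
particular `pRq ⊆ cl~((pRq)_q⁻¹)`. -/
theorem skew_corner_QB (I : TwoSidedIdeal R)
    (hPIS : IsPISIdeal (I : Set R))
    (hEx : IsExchangeIdeal (I : Set R))
    (hEss : IsEssentialIdeal I)
    (p q : R) (hp : p * p = p) (hq : q * q = q) (hpI : p ∈ I)
    (hpq : ∃ r : R, p * r * q ≠ 0)
    (a x b : R) (ha : a = p * a * q) (hx : x = q * x * p) (hb : b = q * b * q)
    (heq : x * a + b = q) :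
    ∃ w c : R, w = p * w * q ∧ c = p * c * q ∧
      (∃ y : R, y = q * y * p ∧ CentOrth (p - w * y) (q - y * w)) ∧
      a + c * b = w := by
  by_cases hb0 : b = 0
  · refine ⟨a, 0, ha, by simp, ⟨x, hx, fun r => ?_⟩, by simp⟩
    rw [hb0, add_zero] at heq
    simp [heq]
  · obtain ⟨s, hss, hsI, hs0⟩ := hEss.exists_idem_left_multiple hPIS hb0
    have hbq : b * q = b := by rw [hb, mul_assoc, hq]
    have hqb : q * b = b := by rw [hb]; simp only [← mul_assoc, hq]
    have hpa : p * a = a := by rw [ha]; simp only [← mul_assoc, hp]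
    have haq : a * q = a := by rw [ha, mul_assoc, hq]
    have hE : (q * s * b) * (q * s * b) = q * s * b := by
      calc (q * s * b) * (q * s * b) = q * (s * (b * q) * (s * b)) := by simp only [mul_assoc]
        _ = q * s * b := by rw [hbq, hss, mul_assoc]
    have hE0 : q * s * b ≠ 0 := fun h => hs0 (by
      calc s * b = s * (b * q) * (s * b) := by rw [hbq, hss]
        _ = s * b * (q * s * b) := by simp only [mul_assoc]
        _ = 0 := by rw [h, mul_zero])
    have hEI : q * s * b ∈ I := by rw [mul_assoc]; exact I.mul_mem_left _ _ hsI
    obtain ⟨u, v, hu, hv, huv⟩ := hPIS.exists_subequiv hp hpI hE hEI hE0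
    obtain ⟨e, he⟩ : ∃ e, e = q * s * b := ⟨_, rfl⟩
    rw [← he] at hE hu hv
    have heq' : e * q = e := by rw [he, mul_assoc, hbq]
    have hqe : q * e = e := by rw [he]; simp only [← mul_assoc, hq]
    have hpu : p * u = u := by rw [hu]; simp only [← mul_assoc, hp]
    have hue : u * e = u := by rw [hu, mul_assoc, hE]
    have huq : u * q = u := by rw [← hue, mul_assoc, heq']
    have hev : e * v = v := by rw [hv]; simp only [← mul_assoc, hE]
    have hvp : v * p = v := by rw [hv, mul_assoc, hp]
    have hqv : q * v = v := by rw [← hev, ← mul_assoc, hqe]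
    have hcb : (u - a * e) * (q * s * q) * b = u - a * e := by
      calc (u - a * e) * (q * s * q) * b = (u - a * e) * (q * s * (q * b)) := by
            simp only [mul_assoc]
        _ = u - a * e := by rw [hqb, ← he, sub_mul, hue, mul_assoc, hE]
    have hpc : p * (u - a * e) = u - a * e := by
      rw [mul_sub, hpu, ← mul_assoc, hpa]
    have hwv : (a + (u - a * e)) * v = p := by
      calc (a + (u - a * e)) * v = a * v + u * v - a * (e * v) := by noncomm_ring
        _ = p := by rw [hev, huv]; abel
    refine ⟨a + (u - a * e), (u - a * e) * (q * s * q), ?_, ?_, ⟨v, ?_, fun r => ?_⟩, by rw [hcb]⟩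
    · rw [mul_add, hpa, hpc, add_mul, sub_mul, haq, huq, mul_assoc, heq']
    · rw [← mul_assoc p, hpc]
      simp only [mul_assoc, hq]
    · rw [hqv, hvp]
    · simp [hwv]

end
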